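/- Let u be a classical solution with decay weight b of the Zakharov–Kuznetsov–Burgers problem on the strip S. Then for every t > 0: (d/dt)(e^{2bx}, |∇u|² − u³/3)(t) + 2(1+3b)(e^{2bx}, u_{xx}²)(t) + 2b(e^{2bx}, u_{yy}²)(t) + 2(1+4b)(e^{2bx}, u_{xy}²)(t) + (b/2)(e^{2bx}, u⁴)(t) = 4b²(1+2b)(e^{2bx}, |∇u|²)(t) − (4b²(1+2b)/3)(e^{2bx}, u³)(t) + 4b(e^{2bx}, u u_y²)(t) + 2(1+4b)(e^{2bx}, u u_x²)(t), where |∇u|² = u_x² + u_y². -/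

import Mathlib

open MeasureTheory Real Set

/-- The mixed partial derivative `∂_x^i ∂_y^j ∂_t^k u` of a function
`u = u(x, y, t)`, evaluated at `(x, y, t)`. -/
noncomputable def pd (i j k : ℕ) (u : ℝ → ℝ → ℝ → ℝ) (x y t : ℝ) : ℝ :=
  iteratedDeriv i (fun x' => iteratedDeriv j (fun y' => iteratedDeriv k (u x' y') t) y) x

/-- The strip `S = ℝ × (0, B)`. -/
def strip (B : ℝ) : Set (ℝ × ℝ) := Set.univ ×ˢ Set.Ioo 0 B

/-- A classical solution, with decay weight `b`, of the Zakharov–Kuznetsov–Burgers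
initial-boundary value problem on the strip `S = ℝ × (0, B)`:
a smooth function `u(x, y, t)` satisfying the ZKB equation
`u_t - u_xx + u u_x + u_xxx + u_xyy = 0` in `ℝ × (0,B) × (0,∞)`, the Dirichlet
boundary conditions `u(x,0,t) = u(x,B,t) = 0`, and such that for every partial
derivative `∂^α u` of order `|α| ≤ 5` in `x, y, t`, both `|∂^α u|²` and
`e^{2bx} |∂^α u|²` are integrable over `S` for each `t ≥ 0`, with integrals
bounded uniformly for `t` in compact subsets of `[0, ∞)`, and
`(1 + e^{2bx}) |∂^α u(x,y,t)|² → 0` as `|x| → ∞`, uniformly in `y` and locally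
uniformly in `t`. -/
structure IsZKBSolution (B b : ℝ) (u : ℝ → ℝ → ℝ → ℝ) : Prop where
  smooth : ContDiff ℝ (⊤ : ℕ∞) (fun p : ℝ × ℝ × ℝ => u p.1 p.2.1 p.2.2)
  pde : ∀ x : ℝ, ∀ y ∈ Set.Ioo (0:ℝ) B, ∀ t : ℝ, 0 < t →
    pd 0 0 1 u x y t - pd 2 0 0 u x y t + u x y t * pd 1 0 0 u x y t
      + pd 3 0 0 u x y t + pd 1 2 0 u x y t = 0
  bdry0 : ∀ x t : ℝ, 0 ≤ t → u x 0 t = 0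
  bdryB : ∀ x t : ℝ, 0 ≤ t → u x B t = 0
  integ : ∀ i j k : ℕ, i + j + k ≤ 5 → ∀ t : ℝ, 0 ≤ t →
    IntegrableOn (fun p : ℝ × ℝ => (1 + Real.exp (2*b*p.1)) * (pd i j k u p.1 p.2 t)^2)
      (strip B) volume
  bdd : ∀ i j k : ℕ, i + j + k ≤ 5 → ∀ T : ℝ, ∃ M : ℝ, ∀ t ∈ Set.Icc (0:ℝ) T,
    (∫ p in strip B, (1 + Real.exp (2*b*p.1)) * (pd i j k u p.1 p.2 t)^2) ≤ M
  decay : ∀ i j k : ℕ, i + j + k ≤ 5 → ∀ T : ℝ, ∀ ε : ℝ, 0 < ε → ∃ R : ℝ,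
    ∀ x : ℝ, R ≤ |x| → ∀ y ∈ Set.Icc (0:ℝ) B, ∀ t ∈ Set.Icc (0:ℝ) T,
      (1 + Real.exp (2*b*x)) * (pd i j k u x y t)^2 ≤ ε

/-- The derivative of `f` in the direction `v`. -/
noncomputable def dirDeriv (v : ℝ × ℝ × ℝ) (f : ℝ × ℝ × ℝ → ℝ) (p : ℝ × ℝ × ℝ) : ℝ :=
  fderiv ℝ f p v

lemma contDiff_dirDeriv (v : ℝ × ℝ × ℝ) {f : ℝ × ℝ × ℝ → ℝ} (hf : ContDiff ℝ (⊤ : ℕ∞) f) :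
    ContDiff ℝ (⊤ : ℕ∞) (dirDeriv v f) :=
  (hf.fderiv_right (m := (⊤ : ℕ∞)) (by simp)).clm_apply contDiff_const

lemma contDiff_iterate_dirDeriv (v : ℝ × ℝ × ℝ) {f : ℝ × ℝ × ℝ → ℝ}
    (hf : ContDiff ℝ (⊤ : ℕ∞) f) (n : ℕ) : ContDiff ℝ (⊤ : ℕ∞) ((dirDeriv v)^[n] f) := by
  induction n with
  | zero => exact hf
  | succ n ih =>
    rw [Function.iterate_succ_apply']
    exact contDiff_dirDeriv v ih

lemma dirDeriv_comm (v w : ℝ × ℝ × ℝ) {f : ℝ × ℝ × ℝ → ℝ} (hf : ContDiff ℝ (⊤ : ℕ∞) f) :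
    dirDeriv v (dirDeriv w f) = dirDeriv w (dirDeriv v f) := by
  have hd : Differentiable ℝ (fderiv ℝ f) :=
    (hf.fderiv_right (m := (⊤ : ℕ∞)) (by simp)).differentiable (by simp)
  have key : ∀ a c : ℝ × ℝ × ℝ, ∀ p,
      dirDeriv a (dirDeriv c f) p = fderiv ℝ (fderiv ℝ f) p a c := by
    intro a c p
    have h := (hd p).hasFDerivAt.clm_apply (hasFDerivAt_const c p)
    unfold dirDeriv
    rw [h.fderiv]
    simp
  funext p
  rw [key, key]
  exact ((contDiff_infty.1 hf 2).contDiffAt.isSymmSndFDerivAt (by simp)) v w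

lemma dirDeriv_iterate_comm (v w : ℝ × ℝ × ℝ) {f : ℝ × ℝ × ℝ → ℝ}
    (hf : ContDiff ℝ (⊤ : ℕ∞) f) (n : ℕ) :
    dirDeriv v ((dirDeriv w)^[n] f) = (dirDeriv w)^[n] (dirDeriv v f) := by
  induction n with
  | zero => rfl
  | succ n ih =>
    rw [Function.iterate_succ_apply', Function.iterate_succ_apply',
      dirDeriv_comm v w (contDiff_iterate_dirDeriv w hf n), ih]

lemma iteratedDeriv_comp_line {γ : ℝ → ℝ × ℝ × ℝ} {v : ℝ × ℝ × ℝ}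
    (hγ : ∀ s, HasDerivAt γ v s) (n : ℕ) {f : ℝ × ℝ × ℝ → ℝ}
    (hf : ContDiff ℝ (⊤ : ℕ∞) f) (s : ℝ) :
    iteratedDeriv n (fun r => f (γ r)) s = (dirDeriv v)^[n] f (γ s) := by
  induction n generalizing f with
  | zero => simp
  | succ n ih =>
    have h : deriv (fun r => f (γ r)) = fun r => dirDeriv v f (γ r) := by
      funext r
      exact ((hf.differentiable (by simp) (γ r)).hasFDerivAt.comp_hasDerivAt r (hγ r)).deriv
    rw [iteratedDeriv_succ', h, ih (contDiff_dirDeriv v hf), Function.iterate_succ_apply]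

lemma hasDerivAt_line_x (y t s : ℝ) :
    HasDerivAt (fun r : ℝ => ((r, y, t) : ℝ × ℝ × ℝ)) (1, 0, 0) s :=
  (hasDerivAt_id s).prodMk ((hasDerivAt_const s y).prodMk (hasDerivAt_const s t))

lemma hasDerivAt_line_y (x t s : ℝ) :
    HasDerivAt (fun r : ℝ => ((x, r, t) : ℝ × ℝ × ℝ)) (0, 1, 0) s :=
  (hasDerivAt_const s x).prodMk ((hasDerivAt_id s).prodMk (hasDerivAt_const s t))

lemma hasDerivAt_line_t (x y s : ℝ) :
    HasDerivAt (fun r : ℝ => ((x, y, r) : ℝ × ℝ × ℝ)) (0, 0, 1) s :=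
  (hasDerivAt_const s x).prodMk ((hasDerivAt_const s y).prodMk (hasDerivAt_id s))

section PartialDerivatives

variable {u : ℝ → ℝ → ℝ → ℝ}

lemma pd_eq_dirDeriv (hu : ContDiff ℝ (⊤ : ℕ∞) (fun p : ℝ × ℝ × ℝ => u p.1 p.2.1 p.2.2))
    (i j k : ℕ) (p : ℝ × ℝ × ℝ) :
    pd i j k u p.1 p.2.1 p.2.2 = (dirDeriv (1, 0, 0))^[i] ((dirDeriv (0, 1, 0))^[j]
      ((dirDeriv (0, 0, 1))^[k] (fun p : ℝ × ℝ × ℝ => u p.1 p.2.1 p.2.2))) p := by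
  obtain ⟨x, y, t⟩ := p
  have ht := contDiff_iterate_dirDeriv (0, 0, 1) hu k
  have hy := contDiff_iterate_dirDeriv (0, 1, 0) ht j
  rw [← iteratedDeriv_comp_line (fun s => hasDerivAt_line_x y t s) i hy x]
  unfold pd
  congr 1
  funext x'
  rw [← iteratedDeriv_comp_line (fun s => hasDerivAt_line_y x' t s) j ht y]
  congr 1
  funext y'
  rw [← iteratedDeriv_comp_line (fun s => hasDerivAt_line_t x' y' s) k hu t]

lemma contDiff_pd (hu : ContDiff ℝ (⊤ : ℕ∞) (fun p : ℝ × ℝ × ℝ => u p.1 p.2.1 p.2.2)) (i j k : ℕ) :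
    ContDiff ℝ (⊤ : ℕ∞) (fun p : ℝ × ℝ × ℝ => pd i j k u p.1 p.2.1 p.2.2) := by
  rw [funext (pd_eq_dirDeriv hu i j k)]
  exact contDiff_iterate_dirDeriv _
    (contDiff_iterate_dirDeriv _ (contDiff_iterate_dirDeriv _ hu k) j) i

lemma hasDerivAt_pd_line (hu : ContDiff ℝ (⊤ : ℕ∞) (fun p : ℝ × ℝ × ℝ => u p.1 p.2.1 p.2.2))
    {γ : ℝ → ℝ × ℝ × ℝ} {v : ℝ × ℝ × ℝ} {s : ℝ}
    (hγ : HasDerivAt γ v s) (i j k : ℕ) :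
    HasDerivAt (fun r => pd i j k u (γ r).1 (γ r).2.1 (γ r).2.2)
      (dirDeriv v (fun p : ℝ × ℝ × ℝ => pd i j k u p.1 p.2.1 p.2.2) (γ s)) s :=
  ((contDiff_pd hu i j k).differentiable (by simp) (γ s)).hasFDerivAt.comp_hasDerivAt s hγ

lemma hasDerivAt_pd_x (hu : ContDiff ℝ (⊤ : ℕ∞) (fun p : ℝ × ℝ × ℝ => u p.1 p.2.1 p.2.2))
    (i j k : ℕ) (x y t : ℝ) :
    HasDerivAt (fun r => pd i j k u r y t) (pd (i + 1) j k u x y t) x := by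
  have h := hasDerivAt_pd_line hu (hasDerivAt_line_x y t x) i j k
  rw [funext (pd_eq_dirDeriv hu i j k), ← Function.iterate_succ_apply' (dirDeriv (1, 0, 0)),
    ← pd_eq_dirDeriv hu] at h
  exact h

lemma hasDerivAt_pd_y (hu : ContDiff ℝ (⊤ : ℕ∞) (fun p : ℝ × ℝ × ℝ => u p.1 p.2.1 p.2.2))
    (i j k : ℕ) (x y t : ℝ) :
    HasDerivAt (fun r => pd i j k u x r t) (pd i (j + 1) k u x y t) y := by
  have h := hasDerivAt_pd_line hu (hasDerivAt_line_y x t y) i j k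
  have ht := contDiff_iterate_dirDeriv (0, 0, 1) hu k
  have hy := contDiff_iterate_dirDeriv (0, 1, 0) ht j
  rw [funext (pd_eq_dirDeriv hu i j k), dirDeriv_iterate_comm _ _ hy,
    ← Function.iterate_succ_apply' (dirDeriv (0, 1, 0)), ← pd_eq_dirDeriv hu] at h
  exact h

lemma hasDerivAt_pd_t (hu : ContDiff ℝ (⊤ : ℕ∞) (fun p : ℝ × ℝ × ℝ => u p.1 p.2.1 p.2.2))
    (i j k : ℕ) (x y t : ℝ) :
    HasDerivAt (fun r => pd i j k u x y r) (pd i j (k + 1) u x y t) t := by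
  have h := hasDerivAt_pd_line hu (hasDerivAt_line_t x y t) i j k
  have ht := contDiff_iterate_dirDeriv (0, 0, 1) hu k
  have hy := contDiff_iterate_dirDeriv (0, 1, 0) ht j
  rw [funext (pd_eq_dirDeriv hu i j k), dirDeriv_iterate_comm _ _ hy,
    dirDeriv_iterate_comm _ _ ht,
    ← Function.iterate_succ_apply' (dirDeriv (0, 0, 1)), ← pd_eq_dirDeriv hu] at h
  exact h

end PartialDerivatives

/-- The multi-indices `(i, j, k)` with `i + j + k ≤ 5`. -/
def jetIndices : Finset (ℕ × ℕ × ℕ) :=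
  {a ∈ Finset.range 6 ×ˢ Finset.range 6 ×ˢ Finset.range 6 | a.1 + a.2.1 + a.2.2 ≤ 5}

lemma mem_jetIndices {a : ℕ × ℕ × ℕ} : a ∈ jetIndices ↔ a.1 + a.2.1 + a.2.2 ≤ 5 := by
  simp only [jetIndices, Finset.mem_filter, Finset.mem_product, Finset.mem_range]
  omega

/-- The Euclidean norm of the collection of all partial derivatives of `u` of order at most `5`. -/
noncomputable def jetNorm (u : ℝ → ℝ → ℝ → ℝ) (x y t : ℝ) : ℝ :=
  √(∑ a ∈ jetIndices, (pd a.1 a.2.1 a.2.2 u x y t) ^ 2)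

lemma jetNorm_nonneg (u : ℝ → ℝ → ℝ → ℝ) (x y t : ℝ) : 0 ≤ jetNorm u x y t :=
  Real.sqrt_nonneg _

lemma jetNorm_sq (u : ℝ → ℝ → ℝ → ℝ) (x y t : ℝ) :
    jetNorm u x y t ^ 2 = ∑ a ∈ jetIndices, (pd a.1 a.2.1 a.2.2 u x y t) ^ 2 :=
  Real.sq_sqrt (Finset.sum_nonneg fun _ _ => sq_nonneg _)

lemma abs_pd_le_jetNorm {i j k : ℕ} (h : i + j + k ≤ 5) (u : ℝ → ℝ → ℝ → ℝ) (x y t : ℝ) :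
    |pd i j k u x y t| ≤ jetNorm u x y t := by
  have hm : (i, j, k) ∈ jetIndices := mem_jetIndices.2 h
  have hs := Finset.single_le_sum (f := fun a : ℕ × ℕ × ℕ => (pd a.1 a.2.1 a.2.2 u x y t) ^ 2)
    (fun _ _ => sq_nonneg _) hm
  exact Real.abs_le_sqrt hs

/-- `F` is continuous and, on the strip and for times in `[0, T]`, bounded by a multiple of the
`n`-th power of the jet norm of `u`. -/
structure JetBound (B T : ℝ) (u : ℝ → ℝ → ℝ → ℝ) (n : ℕ) (F : ℝ × ℝ × ℝ → ℝ) : Prop where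
  continuous : Continuous F
  bound : ∃ K : ℝ, 0 ≤ K ∧ ∀ x : ℝ, ∀ y ∈ Ioo (0 : ℝ) B, ∀ t ∈ Icc (0 : ℝ) T,
    |F (x, y, t)| ≤ K * jetNorm u x y t ^ n

section JetBound

variable {B b T : ℝ} {u : ℝ → ℝ → ℝ → ℝ} {n m : ℕ} {F G : ℝ × ℝ × ℝ → ℝ}

lemma JetBound.add (hF : JetBound B T u n F) (hG : JetBound B T u n G) :
    JetBound B T u n (fun p => F p + G p) := by
  obtain ⟨K, hK, h⟩ := hF.bound
  obtain ⟨L, hL, h'⟩ := hG.bound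
  refine ⟨hF.continuous.add hG.continuous, K + L, add_nonneg hK hL, fun x y hy t ht => ?_⟩
  calc |F (x, y, t) + G (x, y, t)| ≤ |F (x, y, t)| + |G (x, y, t)| := abs_add_le _ _
    _ ≤ _ := by linarith [h x y hy t ht, h' x y hy t ht]

lemma JetBound.const_mul (c : ℝ) (hF : JetBound B T u n F) :
    JetBound B T u n (fun p => c * F p) := by
  obtain ⟨K, hK, h⟩ := hF.bound
  refine ⟨continuous_const.mul hF.continuous, |c| * K, by positivity, fun x y hy t ht => ?_⟩
  rw [abs_mul, mul_assoc]
  exact mul_le_mul_of_nonneg_left (h x y hy t ht) (abs_nonneg c)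

lemma JetBound.sub (hF : JetBound B T u n F) (hG : JetBound B T u n G) :
    JetBound B T u n (fun p => F p - G p) := by
  simpa [sub_eq_add_neg] using hF.add (hG.const_mul (-1))

lemma JetBound.mul (hF : JetBound B T u n F) (hG : JetBound B T u m G) :
    JetBound B T u (n + m) (fun p => F p * G p) := by
  obtain ⟨K, hK, h⟩ := hF.bound
  obtain ⟨L, hL, h'⟩ := hG.bound
  refine ⟨hF.continuous.mul hG.continuous, K * L, by positivity, fun x y hy t ht => ?_⟩
  calc |F (x, y, t) * G (x, y, t)| = |F (x, y, t)| * |G (x, y, t)| := abs_mul _ _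
    _ ≤ (K * jetNorm u x y t ^ n) * (L * jetNorm u x y t ^ m) :=
      mul_le_mul (h x y hy t ht) (h' x y hy t ht) (abs_nonneg _)
        ((abs_nonneg _).trans (h x y hy t ht))
    _ = _ := by ring

lemma IsZKBSolution.continuous_pd (hu : IsZKBSolution B b u) (i j k : ℕ) :
    Continuous (fun p : ℝ × ℝ × ℝ => pd i j k u p.1 p.2.1 p.2.2) :=
  (contDiff_pd hu.smooth i j k).continuous

lemma IsZKBSolution.jetBound_pd (hu : IsZKBSolution B b u) (i j k : ℕ) (h : i + j + k ≤ 5) :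
    JetBound B T u 1 (fun p => pd i j k u p.1 p.2.1 p.2.2) :=
  ⟨hu.continuous_pd i j k, 1, zero_le_one, fun x y _ t _ => by
    simpa using abs_pd_le_jetNorm h u x y t⟩

lemma IsZKBSolution.exists_sq_pd_le (hu : IsZKBSolution B b u)
    (T : ℝ) (i j k : ℕ) (h : i + j + k ≤ 5) :
    ∃ K : ℝ, ∀ x : ℝ, ∀ y ∈ Ioo (0 : ℝ) B, ∀ t ∈ Icc (0 : ℝ) T, pd i j k u x y t ^ 2 ≤ K := by
  obtain ⟨R, hR⟩ := hu.decay i j k h T 1 one_pos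
  obtain ⟨C, hC⟩ := ((isCompact_Icc (a := -R) (b := R)).prod ((isCompact_Icc (a := (0 : ℝ))
    (b := B)).prod (isCompact_Icc (a := (0 : ℝ)) (b := T)))).bddAbove_image
      ((hu.continuous_pd i j k).pow 2).continuousOn
  refine ⟨max 1 C, fun x y hy t ht => ?_⟩
  rcases le_total R |x| with hx | hx
  · refine le_max_of_le_left (le_trans ?_ (hR x hx y (Ioo_subset_Icc_self hy) t ht))
    nlinarith [sq_nonneg (pd i j k u x y t), Real.exp_pos (2 * b * x)]
  · exact le_max_of_le_right (hC ⟨(x, y, t),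
      ⟨abs_le.1 hx, Ioo_subset_Icc_self hy, ht⟩, rfl⟩)

lemma IsZKBSolution.exists_jetNorm_le (hu : IsZKBSolution B b u) (T : ℝ) :
    ∃ K : ℝ, ∀ x : ℝ, ∀ y ∈ Ioo (0 : ℝ) B, ∀ t ∈ Icc (0 : ℝ) T, jetNorm u x y t ≤ K := by
  have h : ∀ a : ℕ × ℕ × ℕ, ∃ K : ℝ, a ∈ jetIndices → ∀ x : ℝ, ∀ y ∈ Ioo (0 : ℝ) B,
      ∀ t ∈ Icc (0 : ℝ) T, pd a.1 a.2.1 a.2.2 u x y t ^ 2 ≤ K := by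
    intro a
    by_cases ha : a ∈ jetIndices
    · obtain ⟨K, hK⟩ := hu.exists_sq_pd_le T a.1 a.2.1 a.2.2 (mem_jetIndices.1 ha)
      exact ⟨K, fun _ => hK⟩
    · exact ⟨0, fun h => absurd h ha⟩
  choose K hK using h
  exact ⟨√(∑ a ∈ jetIndices, K a), fun x y hy t ht =>
    Real.sqrt_le_sqrt (Finset.sum_le_sum fun a ha => hK a ha x y hy t ht)⟩

lemma IsZKBSolution.jetBound_mono (hu : IsZKBSolution B b u)
    (hnm : n ≤ m) (hF : JetBound B T u m F) :
    JetBound B T u n F := by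
  obtain ⟨K, hK, h⟩ := hF.bound
  obtain ⟨L, hL⟩ := hu.exists_jetNorm_le T
  refine ⟨hF.continuous, K * |L| ^ (m - n), by positivity, fun x y hy t ht => ?_⟩
  have h0 := jetNorm_nonneg u x y t
  calc |F (x, y, t)| ≤ K * jetNorm u x y t ^ m := h x y hy t ht
    _ = K * (jetNorm u x y t ^ (m - n) * jetNorm u x y t ^ n) := by
      rw [← pow_add, Nat.sub_add_cancel hnm]
    _ ≤ K * (|L| ^ (m - n) * jetNorm u x y t ^ n) := by
      gcongr
      exact (hL x y hy t ht).trans (le_abs_self L)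
    _ = _ := by ring

lemma IsZKBSolution.jetBound_mul (hu : IsZKBSolution B b u)
    (hF : JetBound B T u 1 F) (hG : JetBound B T u 1 G) :
    JetBound B T u 1 (fun p => F p * G p) :=
  hu.jetBound_mono one_le_two (hF.mul hG)

lemma IsZKBSolution.integrableOn_jetNorm_sq (hu : IsZKBSolution B b u) {t : ℝ} (ht : 0 ≤ t) :
    IntegrableOn (fun p : ℝ × ℝ => (1 + Real.exp (2*b*p.1)) * jetNorm u p.1 p.2 t ^ 2)
      (strip B) volume := by
  simp only [jetNorm_sq, Finset.mul_sum]
  exact integrable_finsetSum _ fun a ha => hu.integ _ _ _ (mem_jetIndices.1 ha) t ht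

lemma IsZKBSolution.exists_integral_jetNorm_sq_le (hu : IsZKBSolution B b u) (T : ℝ) :
    ∃ M : ℝ, ∀ t ∈ Icc (0 : ℝ) T,
      (∫ p in strip B, (1 + Real.exp (2*b*p.1)) * jetNorm u p.1 p.2 t ^ 2) ≤ M := by
  have h : ∀ a : ℕ × ℕ × ℕ, ∃ M : ℝ, a ∈ jetIndices → ∀ t ∈ Icc (0 : ℝ) T,
      (∫ p in strip B, (1 + Real.exp (2*b*p.1)) * pd a.1 a.2.1 a.2.2 u p.1 p.2 t ^ 2) ≤ M := by
    intro a
    by_cases ha : a ∈ jetIndices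
    · obtain ⟨M, hM⟩ := hu.bdd a.1 a.2.1 a.2.2 (mem_jetIndices.1 ha) T
      exact ⟨M, fun _ => hM⟩
    · exact ⟨0, fun h => absurd h ha⟩
  choose M hM using h
  refine ⟨∑ a ∈ jetIndices, M a, fun t ht => ?_⟩
  simp only [jetNorm_sq, Finset.mul_sum]
  rw [integral_finsetSum _ fun a ha => hu.integ _ _ _ (mem_jetIndices.1 ha) t ht.1]
  exact Finset.sum_le_sum fun a ha => hM a ha t ht

lemma measurableSet_strip (B : ℝ) : MeasurableSet (strip B) :=
  MeasurableSet.univ.prod measurableSet_Ioo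

lemma JetBound.exists_norm_exp_mul_le (b : ℝ) (hF : JetBound B T u 2 F) :
    ∃ K : ℝ, 0 ≤ K ∧ ∀ p ∈ strip B, ∀ t ∈ Icc (0 : ℝ) T,
      ‖Real.exp (2*b*p.1) * F (p.1, p.2, t)‖ ≤
        K * ((1 + Real.exp (2*b*p.1)) * jetNorm u p.1 p.2 t ^ 2) := by
  obtain ⟨K, hK, h⟩ := hF.bound
  refine ⟨K, hK, fun p hp t ht => ?_⟩
  have h1 := h p.1 p.2 hp.2 t ht
  have h2 := Real.exp_pos (2*b*p.1)
  rw [Real.norm_eq_abs, abs_mul, abs_of_pos h2]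
  nlinarith [mul_le_mul_of_nonneg_left h1 h2.le,
    mul_nonneg hK (sq_nonneg (jetNorm u p.1 p.2 t))]

lemma JetBound.continuous_exp_mul (b : ℝ) (hF : JetBound B T u n F) (t : ℝ) :
    Continuous (fun p : ℝ × ℝ => Real.exp (2*b*p.1) * F (p.1, p.2, t)) := by
  have := hF.continuous
  fun_prop

lemma IsZKBSolution.integrableOn_of_jetBound (hu : IsZKBSolution B b u)
    (hF : JetBound B T u 2 F) {t : ℝ}
    (ht : t ∈ Icc (0 : ℝ) T) :
    IntegrableOn (fun p : ℝ × ℝ => Real.exp (2*b*p.1) * F (p.1, p.2, t)) (strip B) volume := by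
  obtain ⟨K, -, h⟩ := hF.exists_norm_exp_mul_le b
  refine Integrable.mono' ((hu.integrableOn_jetNorm_sq ht.1).const_mul K)
    (hF.continuous_exp_mul b t).aestronglyMeasurable ?_
  exact (ae_restrict_mem (measurableSet_strip B)).mono fun p hp => h p hp t ht

lemma IsZKBSolution.exists_integral_norm_le (hu : IsZKBSolution B b u) (hF : JetBound B T u 2 F) :
    ∃ M : ℝ, ∀ t ∈ Icc (0 : ℝ) T,
      (∫ p in strip B, ‖Real.exp (2*b*p.1) * F (p.1, p.2, t)‖) ≤ M := by
  obtain ⟨K, hK, h⟩ := hF.exists_norm_exp_mul_le b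
  obtain ⟨M, hM⟩ := hu.exists_integral_jetNorm_sq_le T
  refine ⟨K * M, fun t ht => ?_⟩
  refine le_trans (setIntegral_mono_on (hu.integrableOn_of_jetBound hF ht).norm
    ((hu.integrableOn_jetNorm_sq ht.1).const_mul K) (measurableSet_strip B)
    fun p hp => h p hp t ht) ?_
  rw [integral_const_mul]
  exact mul_le_mul_of_nonneg_left (hM t ht) hK

end JetBound

/-- Differentiation under the integral sign, when the second derivatives in the parameter are
bounded in `L¹` (rather than pointwise) uniformly in the parameter. -/
lemma hasDerivAt_integral_of_integral_norm_deriv_le {α : Type*} [TopologicalSpace α]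
    [SecondCountableTopology α] [MeasurableSpace α] [OpensMeasurableSpace α]
    {μ : Measure α} [SFinite μ] {f f' f'' : α × ℝ → ℝ} {T M t : ℝ}
    (hf : Continuous f) (hf' : Continuous f') (hf'' : Continuous f'')
    (hd : ∀ p s, HasDerivAt (fun r => f (p, r)) (f' (p, s)) s)
    (hd' : ∀ p s, HasDerivAt (fun r => f' (p, r)) (f'' (p, s)) s)
    (ht : t ∈ Ioo 0 T)
    (hi : Integrable (fun p => f (p, t)) μ) (hi' : Integrable (fun p => f' (p, t)) μ)
    (hi'' : ∀ s ∈ Icc 0 T, Integrable (fun p => f'' (p, s)) μ)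
    (hM : ∀ s ∈ Icc 0 T, ∫ p, ‖f'' (p, s)‖ ∂μ ≤ M) :
    HasDerivAt (fun s => ∫ p, f (p, s) ∂μ) (∫ p, f' (p, t) ∂μ) t := by
  have hprod : Integrable f'' (μ.prod (volume.restrict (Icc 0 T))) := by
    rw [integrable_prod_iff' hf''.aestronglyMeasurable]
    refine ⟨(ae_restrict_mem measurableSet_Icc).mono hi'', ?_⟩
    refine Integrable.mono' (integrable_const M)
      (hf''.norm.comp continuous_swap).aestronglyMeasurable.integral_prod_right' ?_
    filter_upwards [ae_restrict_mem measurableSet_Icc] with s hs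
    rw [Real.norm_of_nonneg (integral_nonneg fun _ => norm_nonneg _)]
    exact hM s hs
  have hbound : Integrable (fun p => ‖f' (p, t)‖ + ∫ s in Icc 0 T, ‖f'' (p, s)‖) μ :=
    hi'.norm.add hprod.norm.integral_prod_left
  refine (hasDerivAt_integral_of_dominated_loc_of_deriv_le (s := Ioo 0 T)
    (F' := fun s p => f' (p, s)) (Ioo_mem_nhds ht.1 ht.2)
    (Filter.Eventually.of_forall fun s => ?_) hi ?_ (Filter.Eventually.of_forall ?_) hbound
    (Filter.Eventually.of_forall fun p s _ => hd p s)).2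
  · exact (hf.comp (by fun_prop : Continuous fun p : α => (p, s))).aestronglyMeasurable
  · exact (hf'.comp (by fun_prop : Continuous fun p : α => (p, t))).aestronglyMeasurable
  intro p s hs
  have hc : Continuous fun r => f'' (p, r) := by fun_prop
  have hsub : uIoc t s ⊆ Icc 0 T := fun r hr => by
    rcases mem_uIoc.1 hr with h | h
    · exact ⟨(ht.1.trans h.1).le, h.2.trans hs.2.le⟩
    · exact ⟨(hs.1.trans h.1).le, h.2.trans ht.2.le⟩
  have hftc : f' (p, s) = f' (p, t) + ∫ r in t..s, f'' (p, r) := by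
    rw [intervalIntegral.integral_eq_sub_of_hasDerivAt (fun r _ => hd' p r)
      (hc.intervalIntegrable t s)]
    ring
  calc ‖f' (p, s)‖ ≤ ‖f' (p, t)‖ + ‖∫ r in t..s, f'' (p, r)‖ := by
        rw [hftc]; exact norm_add_le _ _
    _ ≤ ‖f' (p, t)‖ + ∫ r in Icc 0 T, ‖f'' (p, r)‖ := by
        gcongr
        refine intervalIntegral.norm_integral_le_integral_norm_uIoc.trans ?_
        exact setIntegral_mono_set hc.norm.continuousOn.integrableOn_Icc
          (Filter.Eventually.of_forall fun _ => norm_nonneg _) hsub.eventuallyLE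

/-- The partial derivative `∂_x^i ∂_y^j ∂_t^k u` as a function on `ℝ × ℝ × ℝ`. -/
noncomputable def jet (u : ℝ → ℝ → ℝ → ℝ) (i j k : ℕ) (p : ℝ × ℝ × ℝ) : ℝ :=
  pd i j k u p.1 p.2.1 p.2.2

/-- The integral of `e^{2bx} F(x, y, t)` over the strip. -/
noncomputable def weightedIntegral (B b : ℝ) (F : ℝ × ℝ × ℝ → ℝ) (t : ℝ) : ℝ :=
  ∫ p in strip B, Real.exp (2*b*p.1) * F (p.1, p.2, t)

lemma volume_restrict_strip (B : ℝ) :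
    (volume : Measure (ℝ × ℝ)).restrict (strip B) =
      (volume : Measure ℝ).prod (volume.restrict (Ioo 0 B)) := by
  rw [strip, Measure.volume_eq_prod, ← Measure.prod_restrict, Measure.restrict_univ]

section WeightedIntegral

variable {B b T t : ℝ} {u : ℝ → ℝ → ℝ → ℝ} {F F' F'' G : ℝ × ℝ × ℝ → ℝ}

lemma weightedIntegral_const_mul (B b c : ℝ) (F : ℝ × ℝ × ℝ → ℝ) (t : ℝ) :
    weightedIntegral B b (fun p => c * F p) t = c * weightedIntegral B b F t := by
  rw [weightedIntegral, weightedIntegral, ← integral_const_mul]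
  exact integral_congr_ae (.of_forall fun p => by ring)

lemma IsZKBSolution.weightedIntegral_add (hu : IsZKBSolution B b u) (ht : t ∈ Icc 0 T)
    (hF : JetBound B T u 2 F) (hG : JetBound B T u 2 G) :
    weightedIntegral B b (fun p => F p + G p) t =
      weightedIntegral B b F t + weightedIntegral B b G t := by
  simp only [weightedIntegral, mul_add]
  exact integral_add (hu.integrableOn_of_jetBound hF ht) (hu.integrableOn_of_jetBound hG ht)

lemma IsZKBSolution.weightedIntegral_sub (hu : IsZKBSolution B b u) (ht : t ∈ Icc 0 T)
    (hF : JetBound B T u 2 F) (hG : JetBound B T u 2 G) :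
    weightedIntegral B b (fun p => F p - G p) t =
      weightedIntegral B b F t - weightedIntegral B b G t := by
  simp only [weightedIntegral, mul_sub]
  exact integral_sub (hu.integrableOn_of_jetBound hF ht) (hu.integrableOn_of_jetBound hG ht)

lemma IsZKBSolution.jetBound_jet (hu : IsZKBSolution B b u) (i j k : ℕ) (h : i + j + k ≤ 5) :
    JetBound B T u 1 (fun p => jet u i j k p) :=
  hu.jetBound_pd i j k h

lemma JetBound.mul_two (hF : JetBound B T u 1 F) (hG : JetBound B T u 1 G) :
    JetBound B T u 2 (fun p => F p * G p) :=
  hF.mul hG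

/-- The weighted integral of an `x`-derivative, with the derivative of the weight moved to the
left-hand side. -/
lemma IsZKBSolution.weightedIntegral_deriv_x (hu : IsZKBSolution B b u) (ht : t ∈ Icc 0 T)
    (hF : JetBound B T u 2 F) (hF' : JetBound B T u 2 F')
    (hd : ∀ x y, HasDerivAt (fun r => F (r, y, t)) (F' (x, y, t)) x) :
    weightedIntegral B b (fun p => F' p + 2 * b * F p) t = 0 := by
  have hi := hu.integrableOn_of_jetBound hF ht
  have hi' := hu.integrableOn_of_jetBound (hF'.add (hF.const_mul (2 * b))) ht
  rw [IntegrableOn, volume_restrict_strip] at hi hi'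
  rw [weightedIntegral, volume_restrict_strip, integral_prod_symm _ hi']
  refine integral_eq_zero_of_ae ?_
  filter_upwards [hi.prod_left_ae, hi'.prod_left_ae] with y hy hy'
  refine integral_eq_zero_of_hasDerivAt_of_integrable (fun x => ?_) hy' hy
  have he : HasDerivAt (fun r => Real.exp (2*b*r)) (Real.exp (2*b*x) * (2 * b)) x := by
    simpa using ((hasDerivAt_id x).const_mul (2 * b)).exp
  exact (he.mul (hd x y)).congr_deriv (by ring)

/-- The weighted integral of the `y`-derivative of a function vanishing on the boundary of the
strip is zero. -/
lemma IsZKBSolution.weightedIntegral_deriv_y (hu : IsZKBSolution B b u)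
    (hB : 0 < B) (ht : t ∈ Icc 0 T)
    (hF' : JetBound B T u 2 F')
    (hd : ∀ x y, HasDerivAt (fun r => F (x, r, t)) (F' (x, y, t)) y)
    (h0 : ∀ x, F (x, 0, t) = 0) (h1 : ∀ x, F (x, B, t) = 0) :
    weightedIntegral B b F' t = 0 := by
  have hi' := hu.integrableOn_of_jetBound hF' ht
  rw [IntegrableOn, volume_restrict_strip] at hi'
  rw [weightedIntegral, volume_restrict_strip, integral_prod _ hi']
  refine integral_eq_zero_of_ae (.of_forall fun x => ?_)
  have hc : Continuous fun y => F' (x, y, t) := by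
    have := hF'.continuous
    fun_prop
  have hftc := intervalIntegral.integral_eq_sub_of_hasDerivAt (fun y _ => hd x y)
    (hc.intervalIntegrable 0 B)
  rw [h0, h1, sub_zero, intervalIntegral.integral_of_le hB.le,
    integral_Ioc_eq_integral_Ioo] at hftc
  simp [integral_const_mul, hftc]

lemma IsZKBSolution.hasDerivAt_weightedIntegral (hu : IsZKBSolution B b u) (ht : t ∈ Ioo 0 T)
    (hF : JetBound B T u 2 F) (hF' : JetBound B T u 2 F') (hF'' : JetBound B T u 2 F'')
    (hd : ∀ x y s, HasDerivAt (fun r => F (x, y, r)) (F' (x, y, s)) s)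
    (hd' : ∀ x y s, HasDerivAt (fun r => F' (x, y, r)) (F'' (x, y, s)) s) :
    HasDerivAt (weightedIntegral B b F) (weightedIntegral B b F' t) t := by
  have hc : ∀ {H : ℝ × ℝ × ℝ → ℝ}, Continuous H → Continuous
      fun q : (ℝ × ℝ) × ℝ => Real.exp (2*b*q.1.1) * H (q.1.1, q.1.2, q.2) := by
    intro H hH
    fun_prop
  obtain ⟨M, hM⟩ := hu.exists_integral_norm_le hF''
  have ht' := Ioo_subset_Icc_self ht
  exact hasDerivAt_integral_of_integral_norm_deriv_le
    (f := fun q : (ℝ × ℝ) × ℝ => Real.exp (2*b*q.1.1) * F (q.1.1, q.1.2, q.2))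
    (f' := fun q : (ℝ × ℝ) × ℝ => Real.exp (2*b*q.1.1) * F' (q.1.1, q.1.2, q.2))
    (f'' := fun q : (ℝ × ℝ) × ℝ => Real.exp (2*b*q.1.1) * F'' (q.1.1, q.1.2, q.2))
    (hc hF.continuous) (hc hF'.continuous) (hc hF''.continuous)
    (fun p s => (hd p.1 p.2 s).const_mul (Real.exp (2*b*p.1)))
    (fun p s => (hd' p.1 p.2 s).const_mul (Real.exp (2*b*p.1))) ht
    (hu.integrableOn_of_jetBound hF ht') (hu.integrableOn_of_jetBound hF' ht')
    (fun s hs => hu.integrableOn_of_jetBound hF'' hs) hM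

end WeightedIntegral

section EnergyIdentity

variable {B b t : ℝ} {u : ℝ → ℝ → ℝ → ℝ}

lemma jet_eq_zero_of_boundary {y₀ : ℝ} (h : ∀ x t : ℝ, 0 ≤ t → u x y₀ t = 0) (ht : 0 < t)
    (i k : ℕ) (x : ℝ) : jet u i 0 k (x, y₀, t) = 0 := by
  have hk : ∀ x', iteratedDeriv k (u x' y₀) t = 0 := fun x' => by
    have : u x' y₀ =ᶠ[nhds t] fun _ => 0 := by
      filter_upwards [Ioi_mem_nhds ht] with s hs using h x' s (le_of_lt hs)
    rw [this.iteratedDeriv_eq]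
    simp
  simp [jet, pd, hk]

lemma IsZKBSolution.hasDerivAt_jet_x (hu : IsZKBSolution B b u) (i j k : ℕ) (x y t : ℝ) :
    HasDerivAt (fun r => jet u i j k (r, y, t)) (jet u (i + 1) j k (x, y, t)) x :=
  hasDerivAt_pd_x hu.smooth i j k x y t

lemma IsZKBSolution.hasDerivAt_jet_y (hu : IsZKBSolution B b u) (i j k : ℕ) (x y t : ℝ) :
    HasDerivAt (fun r => jet u i j k (x, r, t)) (jet u i (j + 1) k (x, y, t)) y :=
  hasDerivAt_pd_y hu.smooth i j k x y t

lemma IsZKBSolution.hasDerivAt_jet_t (hu : IsZKBSolution B b u) (i j k : ℕ) (x y t : ℝ) :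
    HasDerivAt (fun r => jet u i j k (x, y, r)) (jet u i j (k + 1) (x, y, t)) t :=
  hasDerivAt_pd_t hu.smooth i j k x y t

/-- The time derivative of the weighted energy, by differentiation under the integral sign. -/
lemma IsZKBSolution.hasDerivAt_energy (hu : IsZKBSolution B b u) (ht : 0 < t) :
    HasDerivAt (weightedIntegral B b fun p => jet u 1 0 0 p * jet u 1 0 0 p
        + jet u 0 1 0 p * jet u 0 1 0 p - 1/3 * (jet u 0 0 0 p * (jet u 0 0 0 p * jet u 0 0 0 p)))
      (weightedIntegral B b (fun p => 2 * (jet u 1 0 0 p * jet u 1 0 1 p)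
        + 2 * (jet u 0 1 0 p * jet u 0 1 1 p)
        - jet u 0 0 0 p * (jet u 0 0 0 p * jet u 0 0 1 p)) t) t := by
  refine hu.hasDerivAt_weightedIntegral (T := t + 1)
    (F'' := fun p => 2 * (jet u 1 0 1 p * jet u 1 0 1 p) + 2 * (jet u 1 0 0 p * jet u 1 0 2 p)
        + 2 * (jet u 0 1 1 p * jet u 0 1 1 p) + 2 * (jet u 0 1 0 p * jet u 0 1 2 p)
        - 2 * (jet u 0 0 0 p * (jet u 0 0 1 p * jet u 0 0 1 p))
        - jet u 0 0 0 p * (jet u 0 0 0 p * jet u 0 0 2 p))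
    ⟨ht, by linarith⟩ ?_ ?_ ?_ (fun x y s => ?_) (fun x y s => ?_)
  on_goal 4 =>
    exact HasDerivAt.congr_deriv
      (by
        repeat' first
          | with_reducible exact hu.hasDerivAt_jet_t _ _ _ x y s
          | apply HasDerivAt.fun_sub
          | apply HasDerivAt.fun_add
          | apply HasDerivAt.const_mul
          | apply HasDerivAt.fun_mul) (by ring)
  on_goal 4 =>
    exact HasDerivAt.congr_deriv
      (by
        repeat' first
          | with_reducible exact hu.hasDerivAt_jet_t _ _ _ x y s
          | apply HasDerivAt.fun_sub
          | apply HasDerivAt.fun_add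
          | apply HasDerivAt.const_mul
          | apply HasDerivAt.fun_mul) (by ring)
  all_goals
    repeat' first
      | with_reducible refine hu.jetBound_jet _ _ _ (by norm_num)
      | with_reducible refine JetBound.add ?_ ?_
      | with_reducible refine JetBound.sub ?_ ?_
      | with_reducible refine JetBound.const_mul _ ?_
      | with_reducible refine JetBound.mul_two ?_ ?_
      | with_reducible refine hu.jetBound_mul ?_ ?_

/-- The `x`-component of the flux of the weighted energy, divided by the weight. -/
noncomputable def fluxX (b : ℝ) (u : ℝ → ℝ → ℝ → ℝ) (p : ℝ × ℝ × ℝ) : ℝ :=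
  2 * (jet u 1 0 0 p * jet u 0 0 1 p)
    + (jet u 2 0 0 p + jet u 0 2 0 p + 1/2 * (jet u 0 0 0 p * jet u 0 0 0 p))
      * (jet u 2 0 0 p + jet u 0 2 0 p + 1/2 * (jet u 0 0 0 p * jet u 0 0 0 p))
    + 4 * b * ((jet u 2 0 0 p + jet u 0 2 0 p + 1/2
      * (jet u 0 0 0 p * jet u 0 0 0 p)) * jet u 1 0 0 p)
    - 2 * b * (jet u 1 0 0 p * jet u 1 0 0 p)
    + 2 * (1 + 4 * b) * (jet u 1 1 0 p * jet u 0 1 0 p - b * (jet u 0 1 0 p * jet u 0 1 0 p))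
    - (1 + 4 * b) * (jet u 0 0 0 p * (jet u 0 0 0 p * jet u 1 0 0 p) - 2 * b / 3
      * (jet u 0 0 0 p * (jet u 0 0 0 p * jet u 0 0 0 p)))
    - 4 * b ^ 2 / 3 * (jet u 0 0 0 p * (jet u 0 0 0 p * jet u 0 0 0 p))
    - 4 * b ^ 2 * (jet u 1 0 0 p * jet u 1 0 0 p) + 4 * b ^ 2 * (jet u 0 1 0 p * jet u 0 1 0 p)

/-- The `x`-derivative of `fluxX`. -/
noncomputable def fluxXDeriv (b : ℝ) (u : ℝ → ℝ → ℝ → ℝ) (p : ℝ × ℝ × ℝ) : ℝ :=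
  2 * (jet u 2 0 0 p * jet u 0 0 1 p + jet u 1 0 0 p * jet u 1 0 1 p)
    + 2 * ((jet u 2 0 0 p + jet u 0 2 0 p + 1/2 * (jet u 0 0 0 p * jet u 0 0 0 p))
      * (jet u 3 0 0 p + jet u 1 2 0 p + jet u 0 0 0 p * jet u 1 0 0 p))
    + 4 * b * ((jet u 3 0 0 p + jet u 1 2 0 p
      + jet u 0 0 0 p * jet u 1 0 0 p) * jet u 1 0 0 p + (jet u 2 0 0 p + jet u 0 2 0 p
      + 1/2 * (jet u 0 0 0 p * jet u 0 0 0 p)) * jet u 2 0 0 p)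
    - 4 * b * (jet u 1 0 0 p * jet u 2 0 0 p)
    + 2 * (1 + 4 * b) * (jet u 2 1 0 p * jet u 0 1 0 p + jet u 1 1 0 p * jet u 1 1 0 p
      - 2 * b * (jet u 0 1 0 p * jet u 1 1 0 p))
    - (1 + 4 * b) * (2 * (jet u 0 0 0 p * (jet u 1 0 0 p * jet u 1 0 0 p))
      + jet u 0 0 0 p * (jet u 0 0 0 p * jet u 2 0 0 p) - 2 * b * (jet u 0 0 0 p
      * (jet u 0 0 0 p * jet u 1 0 0 p)))
    - 4 * b ^ 2 * (jet u 0 0 0 p * (jet u 0 0 0 p * jet u 1 0 0 p))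
    - 8 * b ^ 2 * (jet u 1 0 0 p * jet u 2 0 0 p) + 8 * b ^ 2 * (jet u 0 1 0 p * jet u 1 1 0 p)

/-- The `y`-component of the flux of the weighted energy, divided by the weight. -/
noncomputable def fluxY (b : ℝ) (u : ℝ → ℝ → ℝ → ℝ) (p : ℝ × ℝ × ℝ) : ℝ :=
  2 * (jet u 0 1 0 p * jet u 0 0 1 p) - 2 * (1 + 4 * b) * (jet u 2 0 0 p * jet u 0 1 0 p)
    - 2 * b * (jet u 0 0 0 p * (jet u 0 0 0 p * jet u 0 1 0 p))
    - 8 * b ^ 2 * (jet u 0 1 0 p * jet u 1 0 0 p)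

/-- The `y`-derivative of `fluxY`. -/
noncomputable def fluxYDeriv (b : ℝ) (u : ℝ → ℝ → ℝ → ℝ) (p : ℝ × ℝ × ℝ) : ℝ :=
  2 * (jet u 0 2 0 p * jet u 0 0 1 p + jet u 0 1 0 p * jet u 0 1 1 p)
    - 2 * (1 + 4 * b) * (jet u 2 1 0 p * jet u 0 1 0 p + jet u 2 0 0 p * jet u 0 2 0 p)
    - 2 * b * (2 * (jet u 0 0 0 p * (jet u 0 1 0 p * jet u 0 1 0 p)) + jet u 0 0 0 p
      * (jet u 0 0 0 p * jet u 0 2 0 p))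
    - 8 * b ^ 2 * (jet u 0 2 0 p * jet u 1 0 0 p + jet u 0 1 0 p * jet u 1 1 0 p)

lemma IsZKBSolution.jetBound_fluxes (hu : IsZKBSolution B b u)
    (T : ℝ) : JetBound B T u 2 (fluxX b u) ∧
    JetBound B T u 2 (fluxXDeriv b u) ∧ JetBound B T u 2 (fluxYDeriv b u) := by
  unfold fluxX fluxXDeriv fluxYDeriv
  refine ⟨?_, ?_, ?_⟩
  all_goals
    repeat' first
      | with_reducible refine hu.jetBound_jet _ _ _ (by norm_num)
      | with_reducible refine JetBound.add ?_ ?_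
      | with_reducible refine JetBound.sub ?_ ?_
      | with_reducible refine JetBound.const_mul _ ?_
      | with_reducible refine JetBound.mul_two ?_ ?_
      | with_reducible refine hu.jetBound_mul ?_ ?_

lemma IsZKBSolution.weightedIntegral_fluxXDeriv (hu : IsZKBSolution B b u) (ht : 0 < t) :
    weightedIntegral B b (fun p => fluxXDeriv b u p + 2 * b * fluxX b u p) t = 0 := by
  obtain ⟨hX, hX', -⟩ := hu.jetBound_fluxes t
  refine hu.weightedIntegral_deriv_x (T := t) ⟨ht.le, le_rfl⟩ hX hX' (fun x y => ?_)
  · unfold fluxX fluxXDeriv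
    exact HasDerivAt.congr_deriv
      (by
        repeat' first
          | with_reducible exact hu.hasDerivAt_jet_x _ _ _ x y t
          | apply HasDerivAt.fun_sub
          | apply HasDerivAt.fun_add
          | apply HasDerivAt.const_mul
          | apply HasDerivAt.fun_mul) (by ring)

lemma IsZKBSolution.weightedIntegral_fluxYDeriv (hu : IsZKBSolution B b u)
    (hB : 0 < B) (ht : 0 < t) :
    weightedIntegral B b (fluxYDeriv b u) t = 0 := by
  refine hu.weightedIntegral_deriv_y (T := t) (F := fluxY b u) hB ⟨ht.le, le_rfl⟩
    (hu.jetBound_fluxes t).2.2 (fun x y => ?_) (fun x => ?_) (fun x => ?_)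
  · unfold fluxY fluxYDeriv
    exact HasDerivAt.congr_deriv
      (by
        repeat' first
          | with_reducible exact hu.hasDerivAt_jet_y _ _ _ x y t
          | apply HasDerivAt.fun_sub
          | apply HasDerivAt.fun_add
          | apply HasDerivAt.const_mul
          | apply HasDerivAt.fun_mul) (by ring)
  · simp [fluxY, jet_eq_zero_of_boundary hu.bdry0 ht]
  · simp [fluxY, jet_eq_zero_of_boundary hu.bdryB ht]

/-- The energy identity, with all terms on one side. -/
lemma IsZKBSolution.energy_balance (hu : IsZKBSolution B b u) (hB : 0 < B) (ht : 0 < t) :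
    weightedIntegral B b (fun p => 2 * (jet u 1 0 0 p * jet u 1 0 1 p) + 2
        * (jet u 0 1 0 p * jet u 0 1 1 p) - jet u 0 0 0 p * (jet u 0 0 0 p * jet u 0 0 1 p)) t
      + 2 * (1 + 3 * b) * weightedIntegral B b (fun p => jet u 2 0 0 p * jet u 2 0 0 p) t
      + 2 * b * weightedIntegral B b (fun p => jet u 0 2 0 p * jet u 0 2 0 p) t
      + 2 * (1 + 4 * b) * weightedIntegral B b (fun p => jet u 1 1 0 p * jet u 1 1 0 p) t
      + b / 2 * weightedIntegral B b (fun p => jet u 0 0 0 p * (jet u 0 0 0 p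
        * (jet u 0 0 0 p * jet u 0 0 0 p))) t
      - 4 * b ^ 2 * (1 + 2 * b) * weightedIntegral B b
        (fun p => jet u 1 0 0 p * jet u 1 0 0 p + jet u 0 1 0 p * jet u 0 1 0 p) t
      + 4 * b ^ 2 * (1 + 2 * b) / 3 * weightedIntegral B b (fun p => jet u 0 0 0 p
        * (jet u 0 0 0 p * jet u 0 0 0 p)) t
      - 4 * b * weightedIntegral B b (fun p => jet u 0 0 0 p * (jet u 0 1 0 p * jet u 0 1 0 p)) t
      - 2 * (1 + 4 * b) * weightedIntegral B b (fun p => jet u 0 0 0 p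
        * (jet u 1 0 0 p * jet u 1 0 0 p)) t = 0 := by
  have ht' : t ∈ Icc 0 t := ⟨ht.le, le_rfl⟩
  obtain ⟨hX, hX', hY'⟩ := hu.jetBound_fluxes t
  have hdiv : weightedIntegral B b
      (fun p => fluxXDeriv b u p + 2 * b * fluxX b u p + fluxYDeriv b u p) t = 0 := by
    rw [hu.weightedIntegral_add ht' (hX'.add (hX.const_mul _)) hY',
      hu.weightedIntegral_fluxXDeriv ht, hu.weightedIntegral_fluxYDeriv hB ht, add_zero]
  have hsum : weightedIntegral B b (fun p =>
      (2 * (jet u 1 0 0 p * jet u 1 0 1 p) + 2 * (jet u 0 1 0 p * jet u 0 1 1 p)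
          - jet u 0 0 0 p * (jet u 0 0 0 p * jet u 0 0 1 p))
        + 2 * (1 + 3 * b) * (jet u 2 0 0 p * jet u 2 0 0 p)
        + 2 * b * (jet u 0 2 0 p * jet u 0 2 0 p)
        + 2 * (1 + 4 * b) * (jet u 1 1 0 p * jet u 1 1 0 p)
        + b / 2 * (jet u 0 0 0 p * (jet u 0 0 0 p * (jet u 0 0 0 p * jet u 0 0 0 p)))
        - 4 * b ^ 2 * (1 + 2 * b) * (jet u 1 0 0 p * jet u 1 0 0 p
          + jet u 0 1 0 p * jet u 0 1 0 p)
        + 4 * b ^ 2 * (1 + 2 * b) / 3 * (jet u 0 0 0 p * (jet u 0 0 0 p * jet u 0 0 0 p))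
        - 4 * b * (jet u 0 0 0 p * (jet u 0 1 0 p * jet u 0 1 0 p))
        - 2 * (1 + 4 * b) * (jet u 0 0 0 p * (jet u 1 0 0 p * jet u 1 0 0 p))) t = 0 := by
    rw [← hdiv]
    refine setIntegral_congr_fun (measurableSet_strip B) fun p hp => ?_
    have hpde := hu.pde p.1 p.2 hp.2 t ht
    simp only [fluxX, fluxXDeriv, fluxYDeriv, jet]
    have h0 : pd 0 0 0 u p.1 p.2 t = u p.1 p.2 t := rfl
    simp only [h0]
    linear_combination -Real.exp (2 * b * p.1) * (2 * (pd 2 0 0 u p.1 p.2 t + pd 0 2 0 u p.1 p.2 t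
      + 1/2 * (u p.1 p.2 t * u p.1 p.2 t)) + 4 * b * pd 1 0 0 u p.1 p.2 t) * hpde
  rw [hu.weightedIntegral_sub ht', hu.weightedIntegral_sub ht', hu.weightedIntegral_add ht',
    hu.weightedIntegral_sub ht', hu.weightedIntegral_add ht', hu.weightedIntegral_add ht',
    hu.weightedIntegral_add ht', hu.weightedIntegral_add ht'] at hsum
  · simpa only [weightedIntegral_const_mul] using hsum
  all_goals
    repeat' first
      | with_reducible refine hu.jetBound_jet _ _ _ (by norm_num)
      | with_reducible refine JetBound.add ?_ ?_
      | with_reducible refine JetBound.sub ?_ ?_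
      | with_reducible refine JetBound.const_mul _ ?_
      | with_reducible refine JetBound.mul_two ?_ ?_
      | with_reducible refine hu.jetBound_mul ?_ ?_

end EnergyIdentity

/-- **The differential identity (4.11)** proved inside Lemma 4.4 of the paper:
for a classical solution `u` with decay weight `b` and every `t > 0`,
`(d/dt)(e^{2bx}, |∇u|² − u³/3)(t) + 2(1+3b)(e^{2bx},u_xx²)(t)
 + 2b(e^{2bx},u_yy²)(t) + 2(1+4b)(e^{2bx},u_xy²)(t) + (b/2)(e^{2bx},u⁴)(t)
 = 4b²(1+2b)(e^{2bx},|∇u|²)(t) − (4b²(1+2b)/3)(e^{2bx},u³)(t)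
   + 4b(e^{2bx},u u_y²)(t) + 2(1+4b)(e^{2bx},u u_x²)(t)`. -/
theorem zkb_H1_identity (B b : ℝ) (hB : 0 < B) (hb : 0 < b)
    (u : ℝ → ℝ → ℝ → ℝ) (hu : IsZKBSolution B b u) :
    ∀ t : ℝ, 0 < t →
      deriv (fun τ => ∫ p in strip B, Real.exp (2*b*p.1) *
          ((pd 1 0 0 u p.1 p.2 τ)^2 + (pd 0 1 0 u p.1 p.2 τ)^2 - (u p.1 p.2 τ)^3/3)) t
        + 2*(1 + 3*b) * (∫ p in strip B, Real.exp (2*b*p.1) * (pd 2 0 0 u p.1 p.2 t)^2)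
        + 2*b * (∫ p in strip B, Real.exp (2*b*p.1) * (pd 0 2 0 u p.1 p.2 t)^2)
        + 2*(1 + 4*b) * (∫ p in strip B, Real.exp (2*b*p.1) * (pd 1 1 0 u p.1 p.2 t)^2)
        + (b/2) * (∫ p in strip B, Real.exp (2*b*p.1) * (u p.1 p.2 t)^4)
      = 4*b^2*(1 + 2*b) * (∫ p in strip B, Real.exp (2*b*p.1) *
            ((pd 1 0 0 u p.1 p.2 t)^2 + (pd 0 1 0 u p.1 p.2 t)^2))
        - (4*b^2*(1 + 2*b)/3) * (∫ p in strip B, Real.exp (2*b*p.1) * (u p.1 p.2 t)^3)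
        + 4*b * (∫ p in strip B, Real.exp (2*b*p.1) * u p.1 p.2 t * (pd 0 1 0 u p.1 p.2 t)^2)
        + 2*(1 + 4*b) * (∫ p in strip B,
            Real.exp (2*b*p.1) * u p.1 p.2 t * (pd 1 0 0 u p.1 p.2 t)^2) := by
  intro t ht
  have hE := (hu.hasDerivAt_energy ht).deriv
  have hbal := hu.energy_balance hB ht
  rw [← hE] at hbal
  have h0 : ∀ x y s, pd 0 0 0 u x y s = u x y s := fun _ _ _ => rfl
  have hD : (fun τ => ∫ p in strip B, Real.exp (2*b*p.1) *
        ((pd 1 0 0 u p.1 p.2 τ)^2 + (pd 0 1 0 u p.1 p.2 τ)^2 - (u p.1 p.2 τ)^3/3)) =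
      weightedIntegral B b fun p => jet u 1 0 0 p * jet u 1 0 0 p
        + jet u 0 1 0 p * jet u 0 1 0 p
        - 1/3 * (jet u 0 0 0 p * (jet u 0 0 0 p * jet u 0 0 0 p)) := by
    funext τ
    refine integral_congr_ae (.of_forall fun p => ?_)
    simp only [jet, h0]
    ring
  rw [hD]
  simp only [weightedIntegral, jet, h0, ← mul_assoc] at hbal ⊢
  simp only [pow_succ, pow_zero, one_mul, ← mul_assoc] at hbal ⊢
  linarith
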